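/- arXiv:1310.2897 — 2 statements merged into one kernel-verified Lean document; each statement's English description precedes it below -/
import Mathlib

section
/- Let P be the set of points of the near hexagon L3×GQ(2,2) and for a geometric hyperplane H let f_H : P → ZMod 2 be the function f_H = 1 + χ_H, where χ_H is the indicator function of H. Then the set {0} ∪ {f_H : H a geometric hyperplane of L3×GQ(2,2)} is an F2-linear subspace of (P → ZMod 2) of dimension 10. -/
/-- The points of GQ(2,2): the 2-element subsets of `Fin 6`. -/
abbrev GQP : Type := {s : Finset (Fin 6) // s.card = 2}

/-- The lines of GQ(2,2): 3-element sets of pairwise disjoint 2-element subsets of `Fin 6`. -/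
def GQLine (L : Finset GQP) : Prop :=
  L.card = 3 ∧ ∀ p ∈ L, ∀ q ∈ L, p ≠ q → Disjoint p.1 q.1

/-- The points of the near hexagon L₃ × GQ(2,2). -/
abbrev NHP : Type := Fin 3 × GQP

/-- The lines of L₃ × GQ(2,2): type-one lines `{(i, q) : i ∈ Fin 3}` for a fixed point `q`
of GQ(2,2), and type-two lines `{(i, q) : q ∈ L}` for a fixed `i` and a line `L` of GQ(2,2). -/
def NHLine (X : Finset NHP) : Prop :=
  (∃ q : GQP, X = Finset.univ.image (fun i : Fin 3 => (i, q))) ∨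
  (∃ (i : Fin 3) (L : Finset GQP), GQLine L ∧ X = L.image (fun q => (i, q)))

/-- A geometric hyperplane of L₃ × GQ(2,2): a proper subset of the point set meeting
every line in exactly 1 or exactly 3 of its points. -/
def NHHyp (H : Finset NHP) : Prop :=
  H ≠ Finset.univ ∧ ∀ X : Finset NHP, NHLine X → (X ∩ H).card = 1 ∨ (X ∩ H).card = 3


/-- `fH H = 1 + χ_H`, where `χ_H` is the indicator function of `H`. -/
def fH (H : Finset NHP) : NHP → ZMod 2 :=
  fun x => 1 + (if x ∈ H then 1 else 0)

/-- The point `{a,b}` of GQ(2,2). -/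
def pt (a b : Fin 6) (h : ({a, b} : Finset (Fin 6)).card = 2 := by decide) : GQP := ⟨{a, b}, h⟩

/-- The coefficient of coordinate `x` at level `i`. -/
def lev (d : Fin 2 → Fin 5 → ZMod 2) (i : Fin 3) (x : Fin 5) : ZMod 2 :=
  if i = 0 then d 0 x else if i = 1 then d 1 x else d 0 x + d 1 x

/-- The parametrization of the Veldkamp space. -/
def phi : (Fin 2 → Fin 5 → ZMod 2) →ₗ[ZMod 2] (NHP → ZMod 2) where
  toFun d := fun y => ∑ x : Fin 5, if x.castSucc ∈ y.2.1 then 0 else lev d y.1 x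
  map_add' d e := by
    funext y
    simp only [Pi.add_apply, ← Finset.sum_add_distrib]
    refine Finset.sum_congr rfl fun x _ => ?_
    simp only [lev, Pi.add_apply]
    split_ifs <;> ring
  map_smul' c d := by
    funext y
    simp only [Pi.smul_apply, smul_eq_mul, Finset.mul_sum, RingHom.id_apply]
    refine Finset.sum_congr rfl fun x _ => ?_
    simp only [lev, Pi.smul_apply, smul_eq_mul]
    split_ifs <;> ring

/-- Vanishing of all line sums. -/
def Good (f : NHP → ZMod 2) : Prop :=
  (∀ q, f (0, q) + f (1, q) + f (2, q) = 0) ∧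
  ∀ i (p q r : GQP), Disjoint p.1 q.1 → Disjoint p.1 r.1 → Disjoint q.1 r.1 →
    f (i, p) + f (i, q) + f (i, r) = 0


theorem phi_good (d) : Good (phi d) := by
  constructor
  · intro q
    simp only [phi, LinearMap.coe_mk, AddHom.coe_mk, ← Finset.sum_add_distrib]
    refine Finset.sum_eq_zero fun x _ => ?_
    simp only [lev]
    split_ifs <;> grind
  · intro i p q r h1 h2 h3
    simp only [phi, LinearMap.coe_mk, AddHom.coe_mk, ← Finset.sum_add_distrib]
    refine Finset.sum_eq_zero fun x _ => ?_
    have hc : (p.1 ∪ q.1 ∪ r.1).card = 6 := by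
      rw [Finset.card_union_of_disjoint (Finset.disjoint_union_left.2 ⟨h2, h3⟩),
        Finset.card_union_of_disjoint h1, p.2, q.2, r.2]
    have hu : p.1 ∪ q.1 ∪ r.1 = Finset.univ := by
      rw [← Finset.card_eq_iff_eq_univ, hc]; rfl
    have hx : x.castSucc ∈ p.1 ∪ q.1 ∪ r.1 := hu ▸ Finset.mem_univ _
    have a1 : x.castSucc ∈ p.1 → x.castSucc ∉ q.1 := fun h => (Finset.disjoint_left.1 h1) h
    have a2 : x.castSucc ∈ p.1 → x.castSucc ∉ r.1 := fun h => (Finset.disjoint_left.1 h2) h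
    have a3 : x.castSucc ∈ q.1 → x.castSucc ∉ r.1 := fun h => (Finset.disjoint_left.1 h3) h
    simp only [Finset.mem_union] at hx
    generalize lev d i x = t
    split_ifs <;> grind

theorem pt_cases : ∀ p : GQP, p = pt 0 1 ∨ p = pt 0 2 ∨ p = pt 0 3 ∨ p = pt 0 4 ∨ p = pt 0 5 ∨
    p = pt 1 2 ∨ p = pt 1 3 ∨ p = pt 1 4 ∨ p = pt 1 5 ∨ p = pt 2 3 ∨ p = pt 2 4 ∨ p = pt 2 5 ∨
    p = pt 3 4 ∨ p = pt 3 5 ∨ p = pt 4 5 := by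
  decide +kernel

/-- The parameter recovered from a function. -/
def back (f : NHP → ZMod 2) : Fin 2 → Fin 5 → ZMod 2 := fun i x =>
  let j : Fin 3 := i.castSucc
  let S := f (j, pt 0 1) + f (j, pt 0 5) + f (j, pt 1 5)
  S + ![f (j, pt 0 5), f (j, pt 1 5), f (j, pt 2 5), f (j, pt 3 5), f (j, pt 4 5)] x

theorem phi_apply (d) (i : Fin 3) (a b : Fin 6) (h) : phi d (i, pt a b h) =
    (if 0 = a ∨ 0 = b then 0 else lev d i 0) + (if 1 = a ∨ 1 = b then 0 else lev d i 1) +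
    (if 2 = a ∨ 2 = b then 0 else lev d i 2) + (if 3 = a ∨ 3 = b then 0 else lev d i 3) +
    (if 4 = a ∨ 4 = b then 0 else lev d i 4) := by
  simp only [phi, LinearMap.coe_mk, AddHom.coe_mk, Fin.sum_univ_five, pt, Finset.mem_insert,
    Finset.mem_singleton]
  rfl

theorem back_phi (d) : back (phi d) = d := by
  funext i x
  fin_cases i <;> fin_cases x <;> simp [back, phi_apply, lev] <;> grind

theorem good_ext (f g : NHP → ZMod 2) (hf : Good f) (hg : Good g)
    (h : ∀ i : Fin 2, ∀ q, f (i.castSucc, q) = g (i.castSucc, q)) : f = g := by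
  funext ⟨i, q⟩
  have h0 := h 0 q
  have h1 := h 1 q
  have hf' := hf.1 q
  have hg' := hg.1 q
  simp at h0 h1
  fin_cases i
  · exact h0
  · exact h1
  · show f (2, q) = g (2, q)
    rw [h0, h1] at hf'
    exact add_left_cancel (hf'.trans hg'.symm)

theorem phi_back (f) (hf : Good f) : phi (back f) = f := by
  refine good_ext _ _ (phi_good _) hf fun i q => ?_
  obtain ⟨j, hj⟩ : ∃ j : Fin 3, j = i.castSucc := ⟨_, rfl⟩
  have e : ∀ x, lev (back f) j x = back f i x := by
    intro x; subst hj; fin_cases i <;> simp [lev]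
  have H := hf.2 j
  have l1 := H (pt 0 1) (pt 2 3) (pt 4 5) (by decide) (by decide) (by decide)
  have l2 := H (pt 0 1) (pt 2 4) (pt 3 5) (by decide) (by decide) (by decide)
  have l3 := H (pt 0 1) (pt 2 5) (pt 3 4) (by decide) (by decide) (by decide)
  have l4 := H (pt 0 2) (pt 1 3) (pt 4 5) (by decide) (by decide) (by decide)
  have l5 := H (pt 0 2) (pt 1 4) (pt 3 5) (by decide) (by decide) (by decide)
  have l6 := H (pt 0 2) (pt 1 5) (pt 3 4) (by decide) (by decide) (by decide)
  have l7 := H (pt 0 3) (pt 1 2) (pt 4 5) (by decide) (by decide) (by decide)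
  have l8 := H (pt 0 3) (pt 1 4) (pt 2 5) (by decide) (by decide) (by decide)
  have l9 := H (pt 0 3) (pt 1 5) (pt 2 4) (by decide) (by decide) (by decide)
  have l10 := H (pt 0 4) (pt 1 2) (pt 3 5) (by decide) (by decide) (by decide)
  have l11 := H (pt 0 4) (pt 1 3) (pt 2 5) (by decide) (by decide) (by decide)
  have l12 := H (pt 0 4) (pt 1 5) (pt 2 3) (by decide) (by decide) (by decide)
  have l13 := H (pt 0 5) (pt 1 2) (pt 3 4) (by decide) (by decide) (by decide)
  have l14 := H (pt 0 5) (pt 1 3) (pt 2 4) (by decide) (by decide) (by decide)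
  have l15 := H (pt 0 5) (pt 1 4) (pt 2 3) (by decide) (by decide) (by decide)
  rw [← hj]
  clear H hf
  rcases pt_cases q with h | h | h | h | h | h | h | h | h | h | h | h | h | h | h <;>
  · rw [h, phi_apply]
    simp only [e]
    simp [back, ← hj]
    grind

theorem triple_iff (H : Finset NHP) (x y z : NHP) (h1 : x ≠ y) (h2 : x ≠ z) (h3 : y ≠ z) :
    ((({x, y, z} : Finset NHP) ∩ H).card = 1 ∨ (({x, y, z} : Finset NHP) ∩ H).card = 3) ↔
    fH H x + fH H y + fH H z = 0 := by
  have e1 : (1 : ZMod 2) + 1 = 0 := by decide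
  by_cases a : x ∈ H <;> by_cases b : y ∈ H <;> by_cases c : z ∈ H <;>
    simp [fH, a, b, c, Finset.insert_inter_of_mem, Finset.insert_inter_of_notMem,
      Finset.singleton_inter_of_mem, Finset.singleton_inter_of_notMem, h1, h2, h3, e1]

theorem disj_ne {p q : GQP} (h : Disjoint p.1 q.1) : p ≠ q := by
  rintro rfl
  have := p.2
  rw [disjoint_self.1 h] at this
  simp at this

theorem hyp_iff_good (H : Finset NHP) :
    (∀ X : Finset NHP, NHLine X → (X ∩ H).card = 1 ∨ (X ∩ H).card = 3) ↔ Good (fH H) := by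
  have img : ∀ q : GQP, Finset.univ.image (fun i : Fin 3 => (i, q)) =
      ({(0, q), (1, q), (2, q)} : Finset NHP) := by
    intro q
    have : (Finset.univ : Finset (Fin 3)) = {0, 1, 2} := by decide
    rw [this]; simp [Finset.image_insert]
  constructor
  · intro h
    refine ⟨fun q => ?_, fun i p q r h1 h2 h3 => ?_⟩
    · have := h _ (Or.inl ⟨q, rfl⟩)
      rw [img] at this
      exact (triple_iff H _ _ _ (by simp) (by simp) (by simp)).1 this
    · have n1 := disj_ne h1
      have n2 := disj_ne h2
      have n3 := disj_ne h3
      have := h _ (Or.inr ⟨i, {p, q, r}, ⟨Finset.card_eq_three.2 ⟨p, q, r, n1, n2, n3, rfl⟩, by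
        simp only [Finset.mem_insert, Finset.mem_singleton]
        rintro a (rfl | rfl | rfl) b (rfl | rfl | rfl) hab <;>
          first
          | exact absurd rfl hab
          | assumption
          | (apply Disjoint.symm; assumption)⟩, rfl⟩)
      simp only [Finset.image_insert, Finset.image_singleton] at this
      exact (triple_iff H _ _ _ (by simpa using n1) (by simpa using n2) (by simpa using n3)).1 this
  · rintro ⟨g1, g2⟩ X (⟨q, rfl⟩ | ⟨i, L, ⟨hc, hd⟩, rfl⟩)
    · rw [img]
      exact (triple_iff H _ _ _ (by simp) (by simp) (by simp)).2 (g1 q)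
    · obtain ⟨p, q, r, n1, n2, n3, rfl⟩ := Finset.card_eq_three.1 hc
      simp only [Finset.image_insert, Finset.image_singleton]
      exact (triple_iff H _ _ _ (by simpa using n1) (by simpa using n2) (by simpa using n3)).2
        (g2 i p q r (hd _ (by simp) _ (by simp) n1) (hd _ (by simp) _ (by simp) n2)
          (hd _ (by simp) _ (by simp) n3))

/-- The set consisting of `0` and the functions `1 + χ_H`, for `H` ranging over the
geometric hyperplanes of L₃ × GQ(2,2), is an `F₂`-linear subspace of `NHP → ZMod 2`
of dimension 10. -/
theorem veldkamp_space_NH :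
    ∃ W : Submodule (ZMod 2) (NHP → ZMod 2),
      (W : Set (NHP → ZMod 2)) = {0} ∪ {f | ∃ H : Finset NHP, NHHyp H ∧ f = fH H} ∧
      Module.finrank (ZMod 2) W = 10 := by
  refine ⟨LinearMap.range phi, ?_, ?_⟩
  · ext f
    simp only [SetLike.mem_coe, LinearMap.mem_range, Set.mem_union, Set.mem_singleton_iff,
      Set.mem_ofPred_eq]
    constructor
    · rintro ⟨d, rfl⟩
      have hg := phi_good d
      generalize phi d = f at hg
      by_cases h0 : f = 0
      · exact Or.inl h0
      right
      have key : ∀ t : ZMod 2, t = 1 + (if t = 0 then 1 else 0) := by decide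
      have hf : f = fH (Finset.univ.filter fun x => f x = 0) := by
        funext x
        simpa [fH] using key (f x)
      refine ⟨_, ⟨?_, ?_⟩, hf⟩
      · intro hu
        apply h0
        funext x
        have : x ∈ Finset.univ.filter fun x => f x = 0 := by rw [hu]; exact Finset.mem_univ x
        simpa using this
      · rw [hyp_iff_good, ← hf]; exact hg
    · rintro (rfl | ⟨H, hH, rfl⟩)
      · exact ⟨0, map_zero _⟩
      · exact ⟨_, phi_back _ ((hyp_iff_good H).1 hH.2)⟩
  · have hinj : Function.Injective phi := Function.LeftInverse.injective back_phi
    rw [LinearMap.finrank_range_of_inj hinj]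
    simp [Module.finrank_pi_fintype]
end

section
/- Let M be the quotient of the F2-vector space (Fin 6 → ZMod 2) by the span of the constant function 1, with the action of Perm (Fin 6) induced by permuting coordinates. Then this action has exactly 3 orbits on the nonzero vectors of M, of sizes 6, 15 and 10. -/
/-- The span of the constant function `1` in `Fin n → ZMod 2`. -/
def constSpan (n : ℕ) : Submodule (ZMod 2) (Fin n → ZMod 2) :=
  Submodule.span (ZMod 2) {fun _ => 1}

/-- `M`, the quotient of `Fin 6 → ZMod 2` by the span of the constant function `1`. -/
abbrev Mspace := (Fin 6 → ZMod 2) ⧸ constSpan 6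

/-- The linear automorphism of `Fin n → ZMod 2` given by permuting coordinates:
`(σ • f) i = f (σ⁻¹ i)`. -/
def permFun {n : ℕ} (σ : Equiv.Perm (Fin n)) :
    (Fin n → ZMod 2) ≃ₗ[ZMod 2] (Fin n → ZMod 2) :=
  LinearEquiv.funCongrLeft (ZMod 2) (ZMod 2) σ.symm

lemma constSpan_map {n : ℕ} (σ : Equiv.Perm (Fin n)) :
    (constSpan n).map (permFun σ : (Fin n → ZMod 2) →ₗ[ZMod 2] (Fin n → ZMod 2))
      = constSpan n := by
  have h : (permFun σ) (fun _ => 1) = (fun _ => (1 : ZMod 2)) := rfl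
  simp [constSpan, Submodule.map_span, Set.image_singleton, h]

/-- The induced linear action of `Equiv.Perm (Fin n)` on the quotient
`(Fin n → ZMod 2) ⧸ constSpan n`. -/
def quotPerm {n : ℕ} (σ : Equiv.Perm (Fin n)) :
    ((Fin n → ZMod 2) ⧸ constSpan n) ≃ₗ[ZMod 2] ((Fin n → ZMod 2) ⧸ constSpan n) :=
  Submodule.Quotient.equiv _ _ (permFun σ) (constSpan_map σ)

instance : Finite Mspace := Module.finite_of_finite (ZMod 2)

/-- The nonzero vectors of `M`. -/
abbrev MNZ := {v : Mspace // v ≠ 0}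

/-- The orbit relation of `Perm (Fin 6)` on the nonzero vectors of `M`. -/
def orbRel (v w : MNZ) : Prop := ∃ σ : Equiv.Perm (Fin 6), quotPerm σ v.1 = w.1


/-- Number of ones. -/
def wt (f : Fin 6 → ZMod 2) : ℕ := (Finset.univ.filter (fun i => f i = 1)).card

/-- Size of the smaller part of the bipartition. -/
def inv6 (f : Fin 6 → ZMod 2) : ℕ := min (wt f) (6 - wt f)

lemma mk_eq_iff (f g : Fin 6 → ZMod 2) :
    (Submodule.Quotient.mk f : Mspace) = Submodule.Quotient.mk g ↔
      f = g ∨ f = fun i => g i + 1 := by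
  rw [Submodule.Quotient.eq, constSpan, Submodule.mem_span_singleton]
  constructor
  · rintro ⟨a, ha⟩
    have h : ∀ i, f i = g i + a := by
      intro i
      have := congrFun ha i
      simp only [Pi.smul_apply, smul_eq_mul, mul_one, Pi.sub_apply] at this
      rw [this]; ring
    have : a = 0 ∨ a = 1 := (by decide : ∀ a : ZMod 2, a = 0 ∨ a = 1) a
    rcases this with rfl | rfl
    · left; funext i; simpa using h i
    · right; funext i; exact h i
  · rintro (rfl | rfl)
    · exact ⟨0, by simp⟩
    · exact ⟨1, by funext i; simp⟩

lemma wt_add_one (f : Fin 6 → ZMod 2) : wt (fun i => f i + 1) = 6 - wt f := by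
  have h : (Finset.univ.filter (fun i => f i + 1 = 1)) =
      (Finset.univ.filter (fun i => f i = 1))ᶜ := by
    ext i
    simp only [Finset.mem_filter, Finset.mem_univ, true_and, Finset.mem_compl]
    generalize f i = a
    revert a; decide
  rw [wt, h, Finset.card_compl]; rfl

lemma wt_le (f : Fin 6 → ZMod 2) : wt f ≤ 6 := by
  unfold wt
  simpa using Finset.card_le_univ (Finset.univ.filter (fun i => f i = 1))

lemma inv6_add_one (f : Fin 6 → ZMod 2) : inv6 (fun i => f i + 1) = inv6 f := by
  have := wt_le f
  unfold inv6; rw [wt_add_one]; omega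

/-- The invariant on the quotient. -/
def invM (v : Mspace) : ℕ :=
  Quotient.liftOn' v inv6 (by
    intro f g h
    rcases (mk_eq_iff f g).1 (Quotient.sound' h) with rfl | rfl
    · rfl
    · exact inv6_add_one g)

lemma invM_mk (f : Fin 6 → ZMod 2) : invM (Submodule.Quotient.mk f) = inv6 f := rfl

lemma wt_perm (σ : Equiv.Perm (Fin 6)) (f : Fin 6 → ZMod 2) : wt (permFun σ f) = wt f := by
  unfold wt
  refine Finset.card_bij (fun i _ => σ.symm i) ?_ ?_ ?_
  · intro i hi
    exact Finset.mem_filter.2 ⟨Finset.mem_univ _, (Finset.mem_filter.1 hi).2⟩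
  · intro i _ j _ h
    exact σ.symm.injective h
  · intro j hj
    refine ⟨σ j, Finset.mem_filter.2 ⟨Finset.mem_univ _, ?_⟩, by simp⟩
    change f (σ.symm (σ j)) = 1
    rw [Equiv.symm_apply_apply]
    exact (Finset.mem_filter.1 hj).2

lemma exists_perm (f g : Fin 6 → ZMod 2) (h : wt f = wt g) :
    ∃ σ : Equiv.Perm (Fin 6), permFun σ f = g := by
  have hc : Fintype.card {i // f i = 1} = Fintype.card {i // g i = 1} := by
    rw [Fintype.card_subtype, Fintype.card_subtype]; exact h
  let e := Fintype.equivOfCardEq hc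
  refine ⟨e.extendSubtype, ?_⟩
  have key : ∀ i, f i = g (e.extendSubtype i) := by
    intro i
    have two : ∀ a : ZMod 2, a ≠ 1 → a = 0 := by decide
    by_cases hi : f i = 1
    · rw [hi, e.extendSubtype_mem i hi]
    · rw [two _ hi, two _ (e.extendSubtype_not_mem i hi)]
  funext j
  have := key (e.extendSubtype.symm j)
  rw [Equiv.apply_symm_apply] at this
  exact this

lemma quotPerm_mk (σ : Equiv.Perm (Fin 6)) (f : Fin 6 → ZMod 2) :
    quotPerm σ (Submodule.Quotient.mk f : Mspace) = Submodule.Quotient.mk (permFun σ f) := rfl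

lemma orbRel_iff (v w : MNZ) : orbRel v w ↔ invM v.1 = invM w.1 := by
  obtain ⟨v, hv⟩ := v
  obtain ⟨w, hw⟩ := w
  obtain ⟨f, rfl⟩ := Submodule.Quotient.mk_surjective _ v
  obtain ⟨g, rfl⟩ := Submodule.Quotient.mk_surjective _ w
  unfold orbRel
  simp only [quotPerm_mk, invM_mk]
  constructor
  · rintro ⟨σ, h⟩
    have := congrArg invM h
    rw [invM_mk, invM_mk] at this
    rw [← this, inv6, inv6, wt_perm]
  · intro h
    have h1 := wt_le f
    have h2 := wt_le g
    have : wt f = wt g ∨ wt f = wt (fun i => g i + 1) := by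
      rw [wt_add_one]; unfold inv6 at h; omega
    rcases this with h | h
    · obtain ⟨σ, hσ⟩ := exists_perm _ _ h
      exact ⟨σ, by rw [hσ]⟩
    · obtain ⟨σ, hσ⟩ := exists_perm _ _ h
      exact ⟨σ, by rw [hσ]; exact (mk_eq_iff _ _).2 (Or.inr rfl)⟩

/-- Nonzero vectors are parametrized by nonzero functions vanishing at `0`. -/
noncomputable def normEquiv (k : ℕ) :
    {f : Fin 6 → ZMod 2 // (f 0 = 0 ∧ f ≠ 0) ∧ inv6 f = k} ≃ {v : MNZ // invM v.1 = k} :=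
  Equiv.ofBijective
    (fun f => ⟨⟨Submodule.Quotient.mk f.1, by
      intro h
      rcases (mk_eq_iff f.1 0).1 h with h | h
      · exact f.2.1.2 h
      · have := congrFun h 0
        rw [f.2.1.1] at this
        exact absurd this (by decide)⟩, f.2.2⟩) (by
    constructor
    · rintro ⟨f, hf⟩ ⟨g, hg⟩ h
      have h' := congrArg (fun x => x.1.1) h
      rcases (mk_eq_iff f g).1 h' with h | h
      · exact Subtype.ext h
      · have := congrFun h 0
        rw [hf.1.1, hg.1.1] at this
        exact absurd this (by decide)
    · rintro ⟨⟨v, hv⟩, hk⟩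
      obtain ⟨f, rfl⟩ := Submodule.Quotient.mk_surjective _ v
      have hz : f 0 = 0 ∨ f 0 + 1 = 0 := by
        generalize f 0 = a
        revert a; decide
      have hm : (Submodule.Quotient.mk (fun i => f i + 1) : Mspace) = Submodule.Quotient.mk f :=
        (mk_eq_iff _ _).2 (Or.inr rfl)
      rcases hz with hz | hz
      · exact ⟨⟨f, ⟨hz, by rintro rfl; exact hv rfl⟩, hk⟩, rfl⟩
      · refine ⟨⟨fun i => f i + 1, ⟨hz, ?_⟩, ?_⟩, ?_⟩
        · intro h
          rw [h] at hm
          exact hv hm.symm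
        · rw [inv6_add_one]; exact hk
        · exact Subtype.ext (Subtype.ext hm))

set_option maxRecDepth 100000 in
lemma card_fib (k : Fin 3) :
    Nat.card {v : MNZ // invM v.1 = k.1 + 1} = (![6, 15, 10] : Fin 3 → ℕ) k := by
  rw [← Nat.card_congr (normEquiv (k.1 + 1)), Nat.card_eq_fintype_card, Fintype.card_subtype]
  revert k
  decide +kernel

lemma invM_bounds (v : MNZ) : 1 ≤ invM v.1 ∧ invM v.1 ≤ 3 := by
  obtain ⟨v, hv⟩ := v
  obtain ⟨f, rfl⟩ := Submodule.Quotient.mk_surjective _ v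
  have h : ∀ f : Fin 6 → ZMod 2, inv6 f = 0 → f = 0 ∨ f = fun i => (0 : Fin 6 → ZMod 2) i + 1 := by
    decide +kernel
  constructor
  · by_contra hc
    have h0 : inv6 f = 0 := by
      have : ¬ 1 ≤ inv6 f := hc
      omega
    exact hv ((mk_eq_iff f 0).2 (h f h0))
  · change inv6 f ≤ 3
    unfold inv6; omega

/-- The orbit label of a nonzero vector. -/
def lab (v : MNZ) : Fin 3 := ⟨invM v.1 - 1, by have := invM_bounds v; omega⟩

lemma lab_eq_iff (v : MNZ) (k : Fin 3) : lab v = k ↔ invM v.1 = k.1 + 1 := by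
  have := invM_bounds v
  rw [Fin.ext_iff]
  change invM v.1 - 1 = k.1 ↔ _
  omega

lemma lab_orb (v w : MNZ) : orbRel v w ↔ lab v = lab w := by
  have h1 := invM_bounds v
  have h2 := invM_bounds w
  rw [orbRel_iff, Fin.ext_iff]
  change _ ↔ invM v.1 - 1 = invM w.1 - 1
  omega

lemma lab_surj : Function.Surjective lab := by
  intro k
  have h : Nat.card {v : MNZ // invM v.1 = k.1 + 1} ≠ 0 := by
    rw [card_fib]; revert k; decide
  obtain ⟨⟨⟨v, hv⟩⟩, _⟩ := Nat.card_ne_zero.1 h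
  exact ⟨v, (lab_eq_iff v k).2 hv⟩

/-- The orbits are in bijection with `Fin 3`. -/
noncomputable def orbEquiv : Quot orbRel ≃ Fin 3 :=
  Equiv.ofBijective (Quot.lift lab (fun v w h => (lab_orb v w).1 h)) (by
    constructor
    · rintro ⟨v⟩ ⟨w⟩ h
      exact Quot.sound ((lab_orb v w).2 h)
    · intro k
      obtain ⟨v, hv⟩ := lab_surj k
      exact ⟨Quot.mk _ v, hv⟩)

lemma card_orb (q : Quot orbRel) :
    Nat.card {v : MNZ // Quot.mk orbRel v = q} = (![6, 15, 10] : Fin 3 → ℕ) (orbEquiv q) := by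
  rw [← card_fib]
  refine Nat.card_congr (Equiv.subtypeEquivRight fun v => ?_)
  rw [← lab_eq_iff, ← orbEquiv.apply_eq_iff_eq]
  rfl

/-- The action of `Perm (Fin 6)` on the nonzero vectors of `M` has exactly 3 orbits,
of sizes 6, 15, 10 (the ovoids, perp-sets and grids of GQ(2,2)). -/
theorem GQ_hyperplane_orbits :
    Nat.card (Quot orbRel) = 3 ∧
    (haveI : Fintype (Quot orbRel) := Fintype.ofFinite _
    (Finset.univ : Finset (Quot orbRel)).val.map
        (fun q => Nat.card {v : MNZ // Quot.mk orbRel v = q}) =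
      ({6, 15, 10} : Multiset ℕ)) := by
  refine ⟨by rw [Nat.card_congr orbEquiv, Nat.card_fin], ?_⟩
  letI : Fintype (Quot orbRel) := Fintype.ofFinite _
  change (Finset.univ : Finset (Quot orbRel)).val.map
    (fun q => Nat.card {v : MNZ // Quot.mk orbRel v = q}) = _
  simp only [card_orb]
  have h : (Finset.univ : Finset (Quot orbRel)).val.map orbEquiv =
      (Finset.univ : Finset (Fin 3)).val := by
    have := congrArg Finset.val (Finset.map_univ_equiv orbEquiv)
    simpa using this
  have h2 := congrArg (Multiset.map (![6, 15, 10] : Fin 3 → ℕ)) h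
  rw [Multiset.map_map] at h2
  exact h2.trans (by decide)
end
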